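/- The hidden-quantum-memory circuit yields Markovian full statistics but non-Markovian sub-statistics: for the full four-time statistics, whenever P(x_3, x_2, x_1) > 0 the conditional P(x_4 | x_3, x_2, x_1) := P(x_4,x_3,x_2,x_1)/P(x_3,x_2,x_1) equals 1/2 independently of x_2 and x_1, and whenever P(x_2, x_1) > 0 the conditional P(x_3 | x_2, x_1) is independent of x_1; however, for the sub-statistics with no measurement at t_2, whenever P(x_3, 𝓘_2, x_1) > 0 the conditional P(x_4 | x_3, 𝓘_2, x_1) equals 1 if x_4 = x_1 and 0 otherwise, hence depends on x_1 (and there exist x_1 ≠ x_1′ giving different conditionals for the same x_4, x_3). -/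

import Mathlib

open Matrix Kronecker

noncomputable section

/-- Standard-basis projector `|x⟩⟨x|` on a qubit. -/
def proj (x : Fin 2) : Matrix (Fin 2) (Fin 2) ℂ := Matrix.single x x 1

/-- Sharp standard-basis measurement on a qubit: `𝒫^x(A) = |x⟩⟨x| A |x⟩⟨x|`. -/
def measM (x : Fin 2) (A : Matrix (Fin 2) (Fin 2) ℂ) : Matrix (Fin 2) (Fin 2) ℂ :=
  proj x * A * proj x

/-- Optionally measure a qubit: `some x` applies `𝒫^x`, `none` applies the identity. -/
def optMeas (o : Option (Fin 2)) (A : Matrix (Fin 2) (Fin 2) ℂ) :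
    Matrix (Fin 2) (Fin 2) ℂ :=
  o.elim A fun x => measM x A

/-- The Hadamard gate `H = (1/√2)·!![1,1;1,-1]`. -/
def Hgate : Matrix (Fin 2) (Fin 2) ℂ := (Real.sqrt 2 : ℂ)⁻¹ • !![1, 1; 1, -1]

/-- The two-qubit SWAP unitary (first factor = system, second = environment). -/
def SWAPm : Matrix (Fin 2 × Fin 2) (Fin 2 × Fin 2) ℂ :=
  Matrix.of fun p q => if p.1 = q.2 ∧ p.2 = q.1 then 1 else 0

/-- The two-qubit CNOT with the environment (second factor) as control and the
system (first factor) as target: `|s,e⟩ ↦ |s+e, e⟩`. -/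
def CNOTE : Matrix (Fin 2 × Fin 2) (Fin 2 × Fin 2) ℂ :=
  Matrix.of fun p q => if p.2 = q.2 ∧ p.1 = q.1 + q.2 then 1 else 0

/-- Kraus operator `|0⟩⟨+|` of the channel `Υ`. -/
def K0 : Matrix (Fin 2) (Fin 2) ℂ := (Real.sqrt 2 : ℂ)⁻¹ • !![1, 1; 0, 0]

/-- Kraus operator `|1⟩⟨−|` of the channel `Υ`. -/
def K1 : Matrix (Fin 2) (Fin 2) ℂ := (Real.sqrt 2 : ℂ)⁻¹ • !![0, 0; 1, -1]

/-- The channel `id ⊗ Υ` acting on system ⊗ environment, where `Υ` has Kraus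
operators `|0⟩⟨+|` and `|1⟩⟨−|` and acts on the environment. -/
def idTensorUps (A : Matrix (Fin 2 × Fin 2) (Fin 2 × Fin 2) ℂ) :
    Matrix (Fin 2 × Fin 2) (Fin 2 × Fin 2) ℂ :=
  ((1 : Matrix (Fin 2) (Fin 2) ℂ) ⊗ₖ K0) * A * ((1 : Matrix (Fin 2) (Fin 2) ℂ) ⊗ₖ K0)ᴴ +
    ((1 : Matrix (Fin 2) (Fin 2) ℂ) ⊗ₖ K1) * A * ((1 : Matrix (Fin 2) (Fin 2) ℂ) ⊗ₖ K1)ᴴ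

/-- Sharp standard-basis measurement of the system qubit of a two-qubit state. -/
def measSys (x : Fin 2) (A : Matrix (Fin 2 × Fin 2) (Fin 2 × Fin 2) ℂ) :
    Matrix (Fin 2 × Fin 2) (Fin 2 × Fin 2) ℂ :=
  (proj x ⊗ₖ (1 : Matrix (Fin 2) (Fin 2) ℂ)) * A * (proj x ⊗ₖ (1 : Matrix (Fin 2) (Fin 2) ℂ))

/-- The two-qubit (system ⊗ environment) state of the hidden-quantum-memory circuit
(Fig. 2) just before the measurement at time `t₃`: start from `ρ₁ = 𝟙/2`, optionally
measure (`m₁`), apply `H`, optionally measure (`m₂`), adjoin the environment in state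
`τ = |0⟩⟨0|` and apply SWAP. -/
def hqmPre3 (m1 m2 : Option (Fin 2)) : Matrix (Fin 2 × Fin 2) (Fin 2 × Fin 2) ℂ :=
  let ρ1 : Matrix (Fin 2) (Fin 2) ℂ := (1 / 2 : ℂ) • 1
  let a1 := optMeas m1 ρ1
  let a2 := Hgate * a1 * Hgateᴴ
  let a3 := optMeas m2 a2
  SWAPm * (a3 ⊗ₖ proj 0) * SWAPmᴴ

/-- The final subnormalised two-qubit state of the hidden-quantum-memory circuit
(Fig. 2): after `hqmPre3`, measure the system (`𝒫^{x₃}`), apply `id ⊗ Υ`, apply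
`CNOT` controlled on the environment, and measure the system (`𝒫^{x₄}`). -/
def hqmFinal (m1 m2 : Option (Fin 2)) (x3 x4 : Fin 2) :
    Matrix (Fin 2 × Fin 2) (Fin 2 × Fin 2) ℂ :=
  measSys x4 (CNOTE * idTensorUps (measSys x3 (hqmPre3 m1 m2)) * CNOTEᴴ)

/-- Joint probability `P(x₄,x₃,·,·)` (real part of the final trace) for the
hidden-quantum-memory circuit with measurement pattern `m₁, m₂` at times `t₁, t₂`. -/
def hqmP4 (m1 m2 : Option (Fin 2)) (x3 x4 : Fin 2) : ℝ :=
  (hqmFinal m1 m2 x3 x4).trace.re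

/-- Joint probability `P(x₃,·,·)` for the hidden-quantum-memory circuit with
measurement pattern `m₁, m₂` at times `t₁, t₂`. -/
def hqmP3 (m1 m2 : Option (Fin 2)) (x3 : Fin 2) : ℝ :=
  (measSys x3 (hqmPre3 m1 m2)).trace.re

/-- Joint probability `P(x₂,x₁)` for the hidden-quantum-memory circuit, measuring
at both times `t₁` and `t₂`. -/
def hqmP2 (x1 x2 : Fin 2) : ℝ :=
  (measM x2 (Hgate * measM x1 ((1 / 2 : ℂ) • 1) * Hgateᴴ)).trace.re

/-- SWAP exchanges the two tensor factors. -/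
lemma swap_kron (a b : Matrix (Fin 2) (Fin 2) ℂ) :
    SWAPm * (a ⊗ₖ b) * SWAPmᴴ = b ⊗ₖ a := by
  ext ⟨i, j⟩ ⟨k, l⟩
  fin_cases i <;> fin_cases j <;> fin_cases k <;> fin_cases l <;>
    simp [SWAPm, Matrix.mul_apply, Fintype.sum_prod_type] <;> ring

lemma measSys_kron (x : Fin 2) (a b : Matrix (Fin 2) (Fin 2) ℂ) :
    measSys x (a ⊗ₖ b) = measM x a ⊗ₖ b := by
  simp [measSys, measM, ← Matrix.mul_kronecker_mul]

lemma measM_proj_zero (x : Fin 2) : measM x (proj 0) = if x = 0 then proj 0 else 0 := by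
  fin_cases x <;> simp [measM, proj]

lemma inv_sqrt_two_sq : ((Real.sqrt 2 : ℂ))⁻¹ * (Real.sqrt 2 : ℂ)⁻¹ = 1 / 2 := by
  rw [← mul_inv, ← Complex.ofReal_mul, Real.mul_self_sqrt (by norm_num)]
  norm_num

/-- The classical bit distribution created by `Υ`. -/
lemma idTensorUps_kron (a b : Matrix (Fin 2) (Fin 2) ℂ) :
    idTensorUps (b ⊗ₖ a) = b ⊗ₖ !![(a 0 0 + a 0 1 + a 1 0 + a 1 1) / 2, 0;
      0, (a 0 0 - a 0 1 - a 1 0 + a 1 1) / 2] := by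
  have h : K0 * a * K0ᴴ + K1 * a * K1ᴴ = !![(a 0 0 + a 0 1 + a 1 0 + a 1 1) / 2, 0;
      0, (a 0 0 - a 0 1 - a 1 0 + a 1 1) / 2] := by
    have h2 := inv_sqrt_two_sq
    ext i j
    fin_cases i <;> fin_cases j <;>
      simp only [Matrix.add_apply, Matrix.mul_apply, Fin.sum_univ_two,
        Matrix.conjTranspose_apply] <;>
      simp [K0, K1] <;>
      first
      | linear_combination (a 0 0 + a 0 1 + a 1 0 + a 1 1) * h2
      | linear_combination (a 0 0 - a 0 1 - a 1 0 + a 1 1) * h2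
  rw [← h, Matrix.kronecker_add]
  simp [idTensorUps, Matrix.conjTranspose_kronecker, ← Matrix.mul_kronecker_mul]

lemma final_trace (p q : ℂ) (x : Fin 2) :
    (measSys x (CNOTE * (proj 0 ⊗ₖ !![p, 0; 0, q]) * CNOTEᴴ)).trace
      = if x = 0 then p else q := by
  fin_cases x <;>
    simp [measSys, CNOTE, proj, Matrix.trace, Matrix.mul_apply, Fintype.sum_prod_type,
      Matrix.single_apply, Matrix.one_apply]

/-- The state of the system qubit just before the swap. -/
def preSwap (m1 m2 : Option (Fin 2)) : Matrix (Fin 2) (Fin 2) ℂ :=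
  optMeas m2 (Hgate * optMeas m1 ((1 / 2 : ℂ) • 1) * Hgateᴴ)

lemma hqmPre3_eq (m1 m2 : Option (Fin 2)) : hqmPre3 m1 m2 = proj 0 ⊗ₖ preSwap m1 m2 := by
  simp only [hqmPre3, swap_kron, preSwap]

lemma hqmP3_eq (m1 m2 : Option (Fin 2)) (x3 : Fin 2) :
    hqmP3 m1 m2 x3 = if x3 = 0 then (preSwap m1 m2).trace.re else 0 := by
  rw [hqmP3, hqmPre3_eq, measSys_kron, measM_proj_zero]
  split_ifs <;> simp [Matrix.trace_kronecker, proj]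

lemma hqmP4_eq (m1 m2 : Option (Fin 2)) (x4 : Fin 2) :
    hqmP4 m1 m2 0 x4 = (if x4 = 0 then
      (preSwap m1 m2 0 0 + preSwap m1 m2 0 1 + preSwap m1 m2 1 0 + preSwap m1 m2 1 1) / 2
      else (preSwap m1 m2 0 0 - preSwap m1 m2 0 1 - preSwap m1 m2 1 0
        + preSwap m1 m2 1 1) / 2).re := by
  rw [hqmP4, hqmFinal, hqmPre3_eq, measSys_kron, measM_proj_zero, if_pos rfl,
    idTensorUps_kron, final_trace]

lemma preSwap_none (x1 : Fin 2) : preSwap (some x1) none =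
    if x1 = 0 then !![1 / 4, 1 / 4; 1 / 4, 1 / 4] else !![1 / 4, -1 / 4; -1 / 4, 1 / 4] := by
  have h2 := inv_sqrt_two_sq
  ext i j
  fin_cases x1 <;> fin_cases i <;> fin_cases j <;>
    simp only [preSwap, optMeas, Option.elim, measM, Matrix.mul_apply, Fin.sum_univ_two,
      Matrix.conjTranspose_apply] <;>
    simp [proj, Hgate] <;>
    first
    | linear_combination (1 / 2) * h2
    | linear_combination (-1 / 2) * h2

lemma preSwap_some (x1 x2 : Fin 2) : preSwap (some x1) (some x2) = (1 / 4 : ℂ) • proj x2 := by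
  have h : preSwap (some x1) (some x2) = measM x2 (preSwap (some x1) none) := rfl
  rw [h, preSwap_none]
  ext i j
  fin_cases x1 <;> fin_cases x2 <;> fin_cases i <;> fin_cases j <;>
    simp [measM, proj, Matrix.mul_apply, Fin.sum_univ_two, Matrix.single_apply]

lemma hqmP2_eq (x1 x2 : Fin 2) : hqmP2 x1 x2 = 1 / 4 := by
  have h : hqmP2 x1 x2 = (preSwap (some x1) (some x2)).trace.re := rfl
  rw [h, preSwap_some]
  simp [proj]

lemma hqmP3_some (x1 x2 x3 : Fin 2) :
    hqmP3 (some x1) (some x2) x3 = if x3 = 0 then 1 / 4 else 0 := by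
  rw [hqmP3_eq, preSwap_some]
  simp [proj]

lemma hqmP3_none (x1 x3 : Fin 2) :
    hqmP3 (some x1) none x3 = if x3 = 0 then 1 / 2 else 0 := by
  rw [hqmP3_eq, preSwap_none]
  fin_cases x1 <;> simp [Matrix.trace_fin_two] <;> norm_num

lemma hqmP4_some (x1 x2 x4 : Fin 2) : hqmP4 (some x1) (some x2) 0 x4 = 1 / 8 := by
  rw [hqmP4_eq, preSwap_some]
  fin_cases x2 <;> fin_cases x4 <;> simp [proj, Matrix.single_apply] <;> norm_num

lemma hqmP4_none (x1 x4 : Fin 2) :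
    hqmP4 (some x1) none 0 x4 = if x4 = x1 then 1 / 2 else 0 := by
  rw [hqmP4_eq, preSwap_none]
  fin_cases x1 <;> fin_cases x4 <;> simp <;> norm_num

/-- The hidden-quantum-memory circuit yields Markovian full statistics but
non-Markovian sub-statistics: when all four times are measured, the conditional
`P(x₄|x₃,x₂,x₁)` equals `1/2` independently of `x₂, x₁` (whenever defined), and
`P(x₃|x₂,x₁)` is independent of `x₁`; however, for the sub-statistics with no
measurement at `t₂`, the conditional `P(x₄|x₃,𝓘₂,x₁)` equals `1` if `x₄ = x₁` and
`0` otherwise, hence depends on `x₁`, and there exist `x₁ ≠ x₁'` giving different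
conditionals for the same `x₄, x₃`. -/
theorem hqm_markov_full_nonmarkov_sub :
    (∀ x1 x2 x3 x4 : Fin 2, 0 < hqmP3 (some x1) (some x2) x3 →
      hqmP4 (some x1) (some x2) x3 x4 / hqmP3 (some x1) (some x2) x3 = 1 / 2) ∧
    (∀ x1 x1' x2 x3 : Fin 2, 0 < hqmP2 x1 x2 → 0 < hqmP2 x1' x2 →
      hqmP3 (some x1) (some x2) x3 / hqmP2 x1 x2 =
        hqmP3 (some x1') (some x2) x3 / hqmP2 x1' x2) ∧
    (∀ x1 x3 x4 : Fin 2, 0 < hqmP3 (some x1) none x3 →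
      hqmP4 (some x1) none x3 x4 / hqmP3 (some x1) none x3 =
        if x4 = x1 then 1 else 0) ∧
    (∃ x1 x1' x3 x4 : Fin 2, x1 ≠ x1' ∧
      0 < hqmP3 (some x1) none x3 ∧ 0 < hqmP3 (some x1') none x3 ∧
      hqmP4 (some x1) none x3 x4 / hqmP3 (some x1) none x3 ≠
        hqmP4 (some x1') none x3 x4 / hqmP3 (some x1') none x3) := by
  refine ⟨?_, ?_, ?_, ?_⟩
  · intro x1 x2 x3 x4 h
    obtain rfl : x3 = 0 := by
      by_contra hx
      simp [hqmP3_some, hx] at h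
    rw [hqmP4_some, hqmP3_some]
    norm_num
  · intro x1 x1' x2 x3 _ _
    simp only [hqmP3_some, hqmP2_eq]
  · intro x1 x3 x4 h
    obtain rfl : x3 = 0 := by
      by_contra hx
      simp [hqmP3_none, hx] at h
    rw [hqmP4_none, hqmP3_none]
    split_ifs <;> norm_num at *
  · refine ⟨0, 1, 0, 0, by decide, ?_, ?_, ?_⟩ <;>
      simp [hqmP3_none, hqmP4_none]
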